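/- Let G be a universally complete K-space. Every band preserving linear operator T : G → G is order bounded if and only if the complete Boolean algebra 𝔓(G) of band projections of G is σ-distributive. -/

import Mathlib

/-! Statement 3: In a universally complete K-space `G`, every band preserving linear operator
is order bounded if and only if the complete Boolean algebra `𝔓(G)` of band projections of `G`
is σ-distributive. Suprema and infima of band projections are expressed order-theoretically
via the (pointwise-on-positives) order of band projections. -/

universe u

variable {E : Type u}

/-- A band projection. -/
def IsBandProjection [Lattice E] [AddCommGroup E] [Module ℝ E] (π : E →ₗ[ℝ] E) : Prop :=
  π.comp π = π ∧ ∀ x : E, 0 ≤ x → 0 ≤ π x ∧ π x ≤ x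

/-- The order on band projections. -/
def bpLE [Lattice E] [AddCommGroup E] [Module ℝ E] (π ρ : E →ₗ[ℝ] E) : Prop :=
  ∀ x : E, 0 ≤ x → π x ≤ ρ x

/-- `s` is the supremum of the set `A` of band projections in the Boolean algebra `𝔓(E)`. -/
def IsSupBP [Lattice E] [AddCommGroup E] [Module ℝ E] (A : Set (E →ₗ[ℝ] E))
    (s : E →ₗ[ℝ] E) : Prop :=
  IsBandProjection s ∧ (∀ π ∈ A, bpLE π s) ∧
    ∀ ρ : E →ₗ[ℝ] E, IsBandProjection ρ → (∀ π ∈ A, bpLE π ρ) → bpLE s ρ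

/-- `s` is the infimum of the set `A` of band projections in the Boolean algebra `𝔓(E)`. -/
def IsInfBP [Lattice E] [AddCommGroup E] [Module ℝ E] (A : Set (E →ₗ[ℝ] E))
    (s : E →ₗ[ℝ] E) : Prop :=
  IsBandProjection s ∧ (∀ π ∈ A, bpLE s π) ∧
    ∀ ρ : E →ₗ[ℝ] E, IsBandProjection ρ → (∀ π ∈ A, bpLE ρ π) → bpLE ρ s

/-- σ-distributivity of the complete Boolean algebra of band projections:
`⋁ₙ ⋀ₘ b n m = ⋀_{φ:ℕ→ℕ} ⋁ₙ b n (φ n)` for every double sequence of band projections. -/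
def SigmaDistributiveBP [Lattice E] [AddCommGroup E] [Module ℝ E] : Prop :=
  ∀ b : ℕ → ℕ → (E →ₗ[ℝ] E), (∀ n m, IsBandProjection (b n m)) →
    ∀ c : ℕ → (E →ₗ[ℝ] E), (∀ n, IsInfBP (Set.range (b n)) (c n)) →
      ∀ u : E →ₗ[ℝ] E, IsSupBP (Set.range c) u →
        ∀ d : (ℕ → ℕ) → (E →ₗ[ℝ] E),
          (∀ φ : ℕ → ℕ, IsSupBP (Set.range fun n => b n (φ n)) (d φ)) →
          ∀ v : E →ₗ[ℝ] E, IsInfBP (Set.range d) v → u = v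

/-- A band preserving operator. -/
def BandPreserving [Lattice E] [AddCommGroup E] [Module ℝ E] (T : E →ₗ[ℝ] E) : Prop :=
  ∀ x y : E, |x| ⊓ |y| = 0 → |T x| ⊓ |y| = 0

/-- Order bounded: maps order intervals to order bounded sets. -/
def OrderBounded [Lattice E] [AddCommGroup E] [Module ℝ E] (T : E →ₗ[ℝ] E) : Prop :=
  ∀ a b : E, ∃ c d : E, ∀ x : E, a ≤ x → x ≤ b → c ≤ T x ∧ T x ≤ d

section BandProjections

variable [Lattice E] [AddCommGroup E] [IsOrderedAddMonoid E]

theorem add_inf_eq_zero {u v w : E} (hu : 0 ≤ u) (hv : 0 ≤ v) (hw : 0 ≤ w)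
    (huw : u ⊓ w = 0) (hvw : v ⊓ w = 0) : (u + v) ⊓ w = 0 := by
  refine le_antisymm ?_ (le_inf (add_nonneg hu hv) hw)
  have h : (u + v) ⊓ w - v ≤ 0 := huw ▸ le_inf (by simp [inf_le_left])
    ((sub_le_self _ hv).trans inf_le_right)
  exact hvw ▸ le_inf (sub_nonpos.1 h) inf_le_right

theorem abs_sub_of_inf_eq_zero {a b : E} (h : a ⊓ b = 0) : |a - b| = a + b := by
  rw [← sup_sub_inf_eq_abs_sub, ← inf_add_sup a b, inf_comm b a, h, sup_comm, sub_zero, zero_add]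

theorem latticeAbs_eq_zero_iff {x : E} : |x| = 0 ↔ x = 0 :=
  ⟨fun h => le_antisymm (h ▸ le_abs_self x) (neg_nonpos.1 (h ▸ neg_le_abs x)),
    fun h => by rw [h, abs_zero]⟩

theorem eq_zero_of_inf_abs_self {x : E} (h : |x| ⊓ |x| = 0) : x = 0 :=
  latticeAbs_eq_zero_iff.1 (by rwa [inf_idem] at h)

theorem nonneg_of_disjoint_of_add_nonneg {a b : E} (h : |a| ⊓ |b| = 0) (hab : 0 ≤ a + b) :
    0 ≤ a := by
  have h1 : -a ≤ |b| := (neg_le_iff_add_nonneg'.2 hab).trans (le_abs_self b)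
  have h2 : -a ≤ 0 := h ▸ le_inf (neg_le_abs a) h1
  exact neg_nonpos.1 h2

/-- Elements dominated by disjoint elements are disjoint. -/
theorem inf_abs_eq_zero_of_le {x y a b : E} (hxa : |x| ≤ a) (hyb : |y| ≤ b) (h : a ⊓ b = 0) :
    |x| ⊓ |y| = 0 :=
  le_antisymm (h ▸ inf_le_inf hxa hyb) (le_inf (abs_nonneg x) (abs_nonneg y))

variable [Module ℝ E]

theorem linearMap_ext_of_nonneg {f g : E →ₗ[ℝ] E} (h : ∀ x, 0 ≤ x → f x = g x) (x : E) :
    f x = g x := by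
  rw [← posPart_sub_negPart x, map_sub, map_sub, h _ (posPart_nonneg x), h _ (negPart_nonneg x)]

namespace IsBandProjection

variable {π ρ : Module.End ℝ E}

theorem idem (h : IsBandProjection π) (x : E) : π (π x) = π x :=
  LinearMap.congr_fun h.1 x

protected theorem zero : IsBandProjection (0 : Module.End ℝ E) :=
  ⟨by simp, fun x hx => by simpa using hx⟩

theorem map_mono_nonneg (h : IsBandProjection π) {x : E} (hx : 0 ≤ x) : 0 ≤ π x := (h.2 x hx).1

theorem mono (h : IsBandProjection π) {x y : E} (hxy : x ≤ y) : π x ≤ π y := by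
  rw [← sub_nonneg, ← map_sub]
  exact (h.2 _ (sub_nonneg.2 hxy)).1

protected theorem one_sub (h : IsBandProjection π) : IsBandProjection (1 - π) := by
  refine ⟨LinearMap.ext fun x => ?_, fun x hx => ?_⟩
  · simp [h.idem]
  · simpa using (h.2 x hx).symm

theorem inf_one_sub (h : IsBandProjection π) {x y : E} (hx : 0 ≤ x) (hy : 0 ≤ y) :
    π x ⊓ (y - π y) = 0 := by
  have h0 : 0 ≤ π x ⊓ (y - π y) := le_inf (h.2 x hx).1 (sub_nonneg.2 (h.2 y hy).2)
  have h1 := h.one_sub.mono (inf_le_left : π x ⊓ (y - π y) ≤ π x)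
  have h2 := h.mono (inf_le_right : π x ⊓ (y - π y) ≤ y - π y)
  simp only [LinearMap.sub_apply, Module.End.one_apply, h.idem, sub_self, map_sub] at h1 h2
  exact le_antisymm ((sub_nonpos.1 h1).trans h2) h0

theorem map_inf_eq_zero (h : IsBandProjection π) {x y : E} (hx : 0 ≤ x) (hy : 0 ≤ y)
    (hxy : x ⊓ y = 0) : π x ⊓ π y = 0 :=
  le_antisymm (hxy ▸ inf_le_inf (h.2 x hx).2 (h.2 y hy).2) (le_inf (h.2 x hx).1 (h.2 y hy).1)

theorem abs_map (h : IsBandProjection π) (x : E) : |π x| = π |x| := by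
  have := h.map_inf_eq_zero (posPart_nonneg x) (negPart_nonneg x) (posPart_inf_negPart_eq_zero x)
  conv_lhs => rw [← posPart_sub_negPart x, map_sub, abs_sub_of_inf_eq_zero this, ← map_add,
    posPart_add_negPart]

theorem abs_map_le (h : IsBandProjection π) (x : E) : |π x| ≤ |x| :=
  (h.abs_map x).trans_le (h.2 _ (abs_nonneg x)).2

/-- An element of the range is disjoint from every element of the kernel. -/
theorem disjoint (h : IsBandProjection π) {x y : E} (hx : π x = x) (hy : π y = 0) :
    |x| ⊓ |y| = 0 := by
  have := h.inf_one_sub (abs_nonneg x) (abs_nonneg y)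
  rwa [← h.abs_map, ← h.abs_map, hx, hy, abs_zero, sub_zero] at this

theorem comm_aux (hπ : IsBandProjection π) (hρ : IsBandProjection ρ) (x : E) :
    ρ (π (ρ x)) = π (ρ x) := by
  refine linearMap_ext_of_nonneg (f := ρ ∘ₗ π ∘ₗ ρ) (g := π ∘ₗ ρ) (fun x hx => ?_) x
  have h := hρ.one_sub.mono (hπ.2 _ (hρ.map_mono_nonneg hx)).2
  simp only [LinearMap.sub_apply, Module.End.one_apply, hρ.idem, sub_self] at h
  exact le_antisymm (hρ.2 _ (hπ.map_mono_nonneg (hρ.map_mono_nonneg hx))).2 (sub_nonpos.1 h)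

theorem comm (hπ : IsBandProjection π) (hρ : IsBandProjection ρ) (x : E) :
    π (ρ x) = ρ (π x) := by
  have h := comm_aux hπ hρ.one_sub x
  simp only [LinearMap.sub_apply, Module.End.one_apply, map_sub, comm_aux hπ hρ] at h
  simpa [sub_eq_zero, eq_comm] using h

protected theorem mul (hπ : IsBandProjection π) (hρ : IsBandProjection ρ) :
    IsBandProjection (π * ρ) := by
  refine ⟨LinearMap.ext fun x => ?_, fun x hx => ⟨?_, ?_⟩⟩
  · simp [hπ.idem, hρ.idem, hπ.comm hρ]
  · exact hπ.map_mono_nonneg (hρ.map_mono_nonneg hx)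
  · exact (hπ.2 _ (hρ.map_mono_nonneg hx)).2.trans (hρ.2 x hx).2

theorem bpLE_iff (hπ : IsBandProjection π) (hρ : IsBandProjection ρ) :
    bpLE π ρ ↔ ∀ x, ρ (π x) = π x := by
  refine ⟨fun h => linearMap_ext_of_nonneg (f := ρ ∘ₗ π) fun x hx => ?_, fun h x hx => ?_⟩
  · refine le_antisymm (hρ.2 _ (hπ.map_mono_nonneg hx)).2 ?_
    simpa [hπ.idem] using h _ (hπ.map_mono_nonneg hx)
  · rw [← h x]
    exact hρ.mono (hπ.2 x hx).2

end IsBandProjection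

theorem BandPreserving.map_comm {T : E →ₗ[ℝ] E} (hT : BandPreserving T) {π : Module.End ℝ E}
    (hπ : IsBandProjection π) (x : E) : T (π x) = π (T x) := by
  have key : ∀ {ρ : Module.End ℝ E}, IsBandProjection ρ → ∀ y, ρ (T (ρ y)) = T (ρ y) := by
    intro ρ hρ y
    have h := hT _ _ (hρ.disjoint (hρ.idem y) (y := (1 - ρ) (T (ρ y))) (by simp [hρ.idem]))
    rw [inf_eq_right.2 (hρ.one_sub.abs_map_le _), latticeAbs_eq_zero_iff] at h
    exact (sub_eq_zero.1 (by simpa using h)).symm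
  have h := key hπ.one_sub x
  simp only [LinearMap.sub_apply, Module.End.one_apply, map_sub, key hπ] at h
  simpa [sub_eq_zero, eq_comm] using h

end BandProjections

section Existence

variable [Lattice E] [AddCommGroup E] [IsOrderedAddMonoid E] [Module ℝ E] [PosSMulMono ℝ E]

theorem latticeAbs_smul_le (c : ℝ) (x : E) : |c • x| ≤ |c| • |x| := by
  have key : ∀ (c : ℝ) (y : E), y ≤ |x| → -y ≤ |x| → c • y ≤ |c| • |x| := by
    intro c y h₁ h₂
    rcases le_total 0 c with hc | hc
    · rw [abs_of_nonneg hc]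
      exact smul_le_smul_of_nonneg_left h₁ hc
    · rw [abs_of_nonpos hc, ← neg_smul_neg]
      exact smul_le_smul_of_nonneg_left h₂ (neg_nonneg.2 hc)
  refine abs_le'.2 ⟨key c x (le_abs_self x) (neg_le_abs x), ?_⟩
  rw [← smul_neg]
  exact key c (-x) (neg_le_abs x) (by simpa using le_abs_self x)

/-- The disjoint complement of a set. -/
def disjointCompl (A : Set E) : Submodule ℝ E where
  carrier := {z | ∀ a ∈ A, |z| ⊓ |a| = 0}
  zero_mem' := fun a _ => by simp
  add_mem' := fun {x y} hx hy a ha => inf_abs_eq_zero_of_le (abs_add_le x y) le_rfl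
    (add_inf_eq_zero (abs_nonneg x) (abs_nonneg y) (abs_nonneg a) (hx a ha) (hy a ha))
  smul_mem' := fun c x hx a ha => by
    have hn : ∀ n : ℕ, (n • |x|) ⊓ |a| = 0 := by
      intro n
      induction n with
      | zero => simp
      | succ n ih =>
        rw [succ_nsmul]
        exact add_inf_eq_zero (nsmul_nonneg (abs_nonneg x) n) (abs_nonneg x) (abs_nonneg a) ih
          (hx a ha)
    obtain ⟨n, hc⟩ := exists_nat_ge |c|
    refine inf_abs_eq_zero_of_le ((latticeAbs_smul_le c x).trans ?_) le_rfl (hn n)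
    rw [← Nat.cast_smul_eq_nsmul ℝ]
    exact smul_le_smul_of_nonneg_right hc (abs_nonneg x)

theorem mem_disjointCompl_of_abs_le {A : Set E} {x y : E} (hy : y ∈ disjointCompl A)
    (hxy : |x| ≤ |y|) : x ∈ disjointCompl A :=
  fun a ha => inf_abs_eq_zero_of_le hxy le_rfl (hy a ha)

theorem isLUB_mem_disjointCompl {A Z : Set E} (hZ : Z ⊆ disjointCompl A) (hne : Z.Nonempty)
    (hpos : ∀ z ∈ Z, 0 ≤ z) {s : E} (hs : IsLUB Z s) : s ∈ disjointCompl A := by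
  intro a ha
  obtain ⟨z₀, hz₀⟩ := hne
  have hs0 : 0 ≤ s := (hpos z₀ hz₀).trans (hs.1 hz₀)
  rw [abs_of_nonneg hs0]
  have ht : 0 ≤ s ⊓ |a| := le_inf hs0 (abs_nonneg a)
  refine le_antisymm ?_ ht
  suffices s ≤ s - s ⊓ |a| by simpa using this
  refine hs.2 fun z hz => ?_
  have hzt : z ⊓ (s ⊓ |a|) = 0 := by
    refine le_antisymm ?_ (le_inf (hpos z hz) ht)
    have := hZ hz a ha
    rw [abs_of_nonneg (hpos z hz)] at this
    exact this ▸ inf_le_inf_left z inf_le_right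
  rw [le_sub_iff_add_le, ← inf_add_sup, hzt, zero_add]
  exact sup_le (hs.1 hz) inf_le_left

theorem isCompl_disjointCompl
    (hDedekind : ∀ A : Set E, A.Nonempty → BddAbove A → ∃ s : E, IsLUB A s) (A : Set E) :
    IsCompl (disjointCompl (disjointCompl A : Set E)) (disjointCompl A) := by
  set B := disjointCompl A
  set B' := disjointCompl (B : Set E)
  constructor
  · rw [Submodule.disjoint_def]
    exact fun x hx' hx => eq_zero_of_inf_abs_self (hx' x hx)
  · rw [codisjoint_iff, Submodule.eq_top_iff']
    have key : ∀ x : E, 0 ≤ x → x ∈ B' ⊔ B := by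
      intro x hx
      set Z : Set E := {z | z ∈ B' ∧ 0 ≤ z ∧ z ≤ x}
      have h0 : (0 : E) ∈ Z := ⟨zero_mem _, le_rfl, hx⟩
      obtain ⟨s, hs⟩ := hDedekind Z ⟨0, h0⟩ ⟨x, fun z hz => hz.2.2⟩
      have hsB : s ∈ B' := isLUB_mem_disjointCompl (fun z hz => hz.1) ⟨0, h0⟩ (fun z hz => hz.2.1) hs
      have hsx : 0 ≤ x - s := sub_nonneg.2 (hs.2 fun z hz => hz.2.2)
      refine Submodule.mem_sup.2 ⟨s, hsB, x - s, fun a ha => ?_, by abel⟩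
      rw [abs_of_nonneg hsx]
      set v := (x - s) ⊓ |a|
      have hv0 : 0 ≤ v := le_inf hsx (abs_nonneg a)
      refine le_antisymm ?_ hv0
      have haB : a ∈ B' := fun b hb => by
        have := hb a ha
        rwa [inf_comm] at this
      have hvB : v ∈ B' := mem_disjointCompl_of_abs_le haB
        (by rw [abs_of_nonneg hv0]; exact inf_le_right)
      have : s + v ≤ s := hs.1 ⟨add_mem hsB hvB, add_nonneg (hs.1 h0) hv0,
        by rw [← le_sub_iff_add_le']; exact inf_le_left⟩
      simpa using this
    intro x
    rw [← posPart_sub_negPart x]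
    exact sub_mem (key _ (posPart_nonneg x)) (key _ (negPart_nonneg x))

/-- The band projection onto the band generated by a set. -/
theorem exists_bandProjection
    (hDedekind : ∀ A : Set E, A.Nonempty → BddAbove A → ∃ s : E, IsLUB A s) (A : Set E) :
    ∃ π : Module.End ℝ E, IsBandProjection π ∧
    (∀ a ∈ A, π a = a) ∧ ∀ z, (∀ a ∈ A, |z| ⊓ |a| = 0) → π z = 0 := by
  have hc := isCompl_disjointCompl hDedekind A
  set B := disjointCompl A
  set B' := disjointCompl (B : Set E)
  set π := B'.projection B hc
  have hB' : ∀ x ∈ B', π x = x := fun x hx => Submodule.projection_apply_of_mem_left hc hx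
  have hmem : ∀ x, π x ∈ B' := fun x => Submodule.projection_apply_mem hc x
  have hsub : ∀ x, x - π x ∈ B := fun x => by
    rw [← Submodule.projection_apply_eq_zero_iff hc]
    change π (x - π x) = 0
    rw [map_sub, hB' _ (hmem x), sub_self]
  refine ⟨π, ⟨LinearMap.ext fun x => hB' _ (hmem x), fun x hx => ?_⟩, fun a ha => hB' a ?_,
    fun z hz => (Submodule.projection_apply_eq_zero_iff hc).2 hz⟩
  · have h1 : |π x| ⊓ |x - π x| = 0 := hmem x _ (hsub x)
    refine ⟨nonneg_of_disjoint_of_add_nonneg h1 (by simpa using hx), sub_nonneg.1 ?_⟩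
    rw [inf_comm] at h1
    exact nonneg_of_disjoint_of_add_nonneg h1 (by simpa using hx)
  · intro b hb
    have := hb a ha
    rwa [inf_comm] at this

/-- The band projection onto the principal band of an element: it is dominated by every band
projection fixing that element, and a band projection kills it as soon as it kills the element. -/
theorem exists_principal_bandProjection
    (hDedekind : ∀ A : Set E, A.Nonempty → BddAbove A → ∃ s : E, IsLUB A s) (y : E) :
    ∃ π : Module.End ℝ E, IsBandProjection π ∧ π y = y ∧
      ∀ ρ : Module.End ℝ E, IsBandProjection ρ → ρ y = 0 → ρ * π = 0 := by
  obtain ⟨π, hπ, h1, h2⟩ := exists_bandProjection hDedekind {y}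
  refine ⟨π, hπ, h1 y rfl, fun ρ hρ hy => LinearMap.ext fun x => ?_⟩
  rw [Module.End.mul_apply, ← hπ.comm hρ]
  refine h2 _ fun a ha => ?_
  rw [Set.mem_singleton_iff.1 ha]
  exact hρ.disjoint (hρ.idem x) hy

theorem exists_bandProjection_eq_posPart
    (hDedekind : ∀ A : Set E, A.Nonempty → BddAbove A → ∃ s : E, IsLUB A s) (z : E) :
    ∃ π : Module.End ℝ E, IsBandProjection π ∧ π z = z⁺ := by
  obtain ⟨π, hπ, h1, h2⟩ := exists_bandProjection hDedekind {z⁺}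
  refine ⟨π, hπ, ?_⟩
  conv_lhs => rw [← posPart_sub_negPart z]
  rw [map_sub, h1 _ rfl, h2 z⁻, sub_zero]
  rintro a rfl
  rw [abs_of_nonneg (negPart_nonneg z), abs_of_nonneg (posPart_nonneg z), inf_comm,
    posPart_inf_negPart_eq_zero]

theorem exists_isSupBP
    (hDedekind : ∀ A : Set E, A.Nonempty → BddAbove A → ∃ s : E, IsLUB A s)
    {P : Set (E →ₗ[ℝ] E)} (hP : ∀ π ∈ P, IsBandProjection π) : ∃ s, IsSupBP P s := by
  obtain ⟨s, hs, h1, h2⟩ := exists_bandProjection hDedekind {a | ∃ π ∈ P, π a = a}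
  refine ⟨s, hs, fun π hπ => ((hP π hπ).bpLE_iff hs).2 fun x => h1 _ ⟨π, hπ, (hP π hπ).idem x⟩,
    fun ρ hρ hub => (hs.bpLE_iff hρ).2 fun x => ?_⟩
  have : s (x - ρ x) = 0 := h2 _ fun a ⟨π, hπ, ha⟩ => by
    have hρa : ρ a = a := by simpa [ha] using ((hP π hπ).bpLE_iff hρ).1 (hub π hπ) a
    rw [inf_comm]
    exact hρ.disjoint hρa (by simp [hρ.idem])
  rw [map_sub, sub_eq_zero] at this
  rw [this, hρ.comm hs, hρ.idem]

theorem exists_isInfBP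
    (hDedekind : ∀ A : Set E, A.Nonempty → BddAbove A → ∃ s : E, IsLUB A s)
    {P : Set (E →ₗ[ℝ] E)} (hP : ∀ π ∈ P, IsBandProjection π) : ∃ s, IsInfBP P s := by
  obtain ⟨s, hs, h1, h2⟩ := exists_isSupBP hDedekind
    (P := {π | ∃ ρ ∈ P, π = (1 : Module.End ℝ E) - ρ})
    (by rintro _ ⟨ρ, hρ, rfl⟩; exact (hP ρ hρ).one_sub)
  refine ⟨(1 : Module.End ℝ E) - s, hs.one_sub, fun π hπ x hx => ?_, fun ρ hρ hlb x hx => ?_⟩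
  · have := h1 _ ⟨π, hπ, rfl⟩ x hx
    simp only [LinearMap.sub_apply, Module.End.one_apply] at this ⊢
    exact sub_le_comm.1 this
  · have := h2 _ hρ.one_sub (by
      rintro _ ⟨π, hπ, rfl⟩ x hx
      exact sub_le_sub_left (hlb π hπ x hx) x) x hx
    simp only [LinearMap.sub_apply, Module.End.one_apply] at this ⊢
    exact le_sub_comm.1 this

end Existence

section SigmaDistributive

variable [Lattice E] [AddCommGroup E] [IsOrderedAddMonoid E] [Module ℝ E] [PosSMulMono ℝ E]

/-- In a σ-distributive algebra, any sequence of band projections is simultaneously decided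
below any nonzero band projection. -/
theorem SigmaDistributiveBP.exists_deciding
    (hσ : SigmaDistributiveBP (E := E))
    (hDedekind : ∀ A : Set E, A.Nonempty → BddAbove A → ∃ s : E, IsLUB A s)
    {s : ℕ → Module.End ℝ E} (hs : ∀ n, IsBandProjection (s n))
    {π₀ : Module.End ℝ E} (hπ₀ : IsBandProjection π₀) (hne : π₀ ≠ 0) :
    ∃ π : Module.End ℝ E, IsBandProjection π ∧ π ≠ 0 ∧ π * π₀ = π ∧
      ∀ n, (∀ x, s n (π x) = 0) ∨ ∀ x, s n (π x) = π x := by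
  set b : ℕ → ℕ → Module.End ℝ E := fun n m => if m = 0 then s n else 1 - s n with hb_def
  have hb : ∀ n m, IsBandProjection (b n m) := fun n m => by
    by_cases hm : m = 0
    · simpa [b, hm] using hs n
    · simpa [b, hm] using (hs n).one_sub
  have hinf : ∀ n, IsInfBP (Set.range (b n)) (0 : Module.End ℝ E) := by
    refine fun n => ⟨.zero, ?_, fun ρ hρ hlb => ?_⟩
    · rintro _ ⟨m, rfl⟩ x hx
      exact (hb n m).map_mono_nonneg hx
    · refine (hρ.bpLE_iff .zero).2 fun x => ?_
      have h0 := (hρ.bpLE_iff (hs n)).1 (by simpa [b] using hlb _ ⟨0, rfl⟩) x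
      have h1 := (hρ.bpLE_iff (hs n).one_sub).1 (by simpa [b] using hlb _ ⟨1, rfl⟩) x
      simpa [h0] using h1
  have hsup : IsSupBP (Set.range fun _ : ℕ => (0 : Module.End ℝ E)) (0 : Module.End ℝ E) :=
    ⟨.zero, by rintro _ ⟨_, rfl⟩ x hx; exact le_rfl, fun ρ hρ _ x hx => hρ.map_mono_nonneg hx⟩
  have hd : ∀ φ : ℕ → ℕ, ∃ d, IsSupBP (Set.range fun n => b n (φ n)) d := fun φ =>
    exists_isSupBP hDedekind (by rintro _ ⟨n, rfl⟩; exact hb n _)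
  choose d hd using hd
  obtain ⟨v, hv⟩ := exists_isInfBP hDedekind (P := Set.range d)
    (by rintro _ ⟨φ, rfl⟩; exact (hd φ).1)
  have hv0 : 0 = v := hσ b hb (fun _ => 0) hinf 0 hsup d hd v hv
  obtain ⟨φ, hφ⟩ : ∃ φ, (1 - d φ : Module.End ℝ E) * π₀ ≠ 0 := by
    by_contra! hcon
    refine hne (LinearMap.ext fun x => ?_)
    have := (hπ₀.bpLE_iff hv.1).1 (hv.2.2 π₀ hπ₀ ?_) x
    · rw [← this, ← hv0]; rfl
    · rintro _ ⟨φ, rfl⟩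
      refine (hπ₀.bpLE_iff (hd φ).1).2 fun x => ?_
      have := LinearMap.congr_fun (hcon φ) x
      exact (sub_eq_zero.1 (by simpa using this)).symm
  refine ⟨_, (hd φ).1.one_sub.mul hπ₀, hφ, ?_, fun n => ?_⟩
  · rw [mul_assoc]
    congr 1
    exact hπ₀.1
  · have hle : ∀ x, d φ (b n (φ n) x) = b n (φ n) x :=
      ((hb n _).bpLE_iff (hd φ).1).1 ((hd φ).2.1 _ ⟨n, rfl⟩)
    have hzero : ∀ x, b n (φ n) ((1 - d φ : Module.End ℝ E) (π₀ x)) = 0 := fun x => by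
      rw [(hb n _).comm (hd φ).1.one_sub]
      simp [hle]
    by_cases hm : φ n = 0
    · left
      simpa [b, hm] using hzero
    · right
      intro x
      have := hzero x
      simp only [b, hm, if_false] at this
      exact (sub_eq_zero.1 this).symm

theorem nonpos_of_forall_le_smul (hArch : ∀ x y : E, (∀ n : ℕ, n • x ≤ y) → x ≤ 0)
    {y q : E} (hq : 0 ≤ q) (h : ∀ ε : ℝ, 0 < ε → y ≤ ε • q) : y ≤ 0 := by
  refine hArch y q fun n => ?_
  rcases n.eq_zero_or_pos with rfl | hn
  · simpa using hq
  · have hn' : (0 : ℝ) < n := Nat.cast_pos.2 hn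
    have := smul_le_smul_of_nonneg_left (h (n : ℝ)⁻¹ (inv_pos.2 hn')) hn'.le
    rwa [smul_smul, mul_inv_cancel₀ hn'.ne', one_smul, Nat.cast_smul_eq_nsmul] at this

theorem le_of_smul_le_smul_of_ne_zero {a b : ℝ} {q : E} (hq : 0 ≤ q) (hq0 : q ≠ 0)
    (h : a • q ≤ b • q) : a ≤ b := by
  by_contra! hab
  have h2 : (a - b) • q ≤ 0 := by rwa [sub_smul, sub_nonpos]
  have h3 := smul_le_smul_of_nonneg_left h2 (inv_nonneg.2 (sub_pos.2 hab).le)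
  rw [smul_smul, inv_mul_cancel₀ (sub_pos.2 hab).ne', one_smul, smul_zero] at h3
  exact hq0 (le_antisymm h3 hq)

/-- An element comparable with all rational multiples of `q` and dominated by `q` is a multiple
of `q`. -/
theorem exists_eq_smul_of_comparable (hArch : ∀ x y : E, (∀ n : ℕ, n • x ≤ y) → x ≤ 0)
    {p q : E} (hpq : |p| ≤ q) (h : ∀ t : ℚ, (t : ℝ) • q ≤ p ∨ p ≤ (t : ℝ) • q) :
    ∃ r : ℝ, |r| ≤ 1 ∧ p = r • q := by
  have hq : 0 ≤ q := (abs_nonneg p).trans hpq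
  by_cases hq0 : q = 0
  · refine ⟨0, by simp, ?_⟩
    rw [hq0] at hpq
    simpa using latticeAbs_eq_zero_iff.1 (le_antisymm hpq (abs_nonneg p))
  set S : Set ℝ := {r | r • q ≤ p}
  have hub : ∀ r ∈ S, r ≤ 1 := by
    refine fun r hr => le_of_smul_le_smul_of_ne_zero hq hq0 ?_
    rw [one_smul]
    exact le_trans hr ((le_abs_self p).trans hpq)
  have hneg : (-1 : ℝ) ∈ S := by
    change (-1 : ℝ) • q ≤ p
    rw [neg_one_smul]
    exact neg_le.1 ((neg_le_abs p).trans hpq)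
  have hbdd : BddAbove S := ⟨1, hub⟩
  refine ⟨sSup S, abs_le.2 ⟨le_csSup hbdd hneg, csSup_le ⟨_, hneg⟩ hub⟩, le_antisymm ?_ ?_⟩
  · refine sub_nonpos.1 (nonpos_of_forall_le_smul hArch hq fun ε hε => ?_)
    obtain ⟨t, ht1, ht2⟩ := exists_rat_btwn (lt_add_of_pos_right (sSup S) hε)
    have : p ≤ (t : ℝ) • q := (h t).resolve_left fun hS => (le_csSup hbdd hS).not_gt ht1
    rw [sub_le_iff_le_add', ← add_smul]
    exact this.trans (smul_le_smul_of_nonneg_right ht2.le hq)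
  · refine sub_nonpos.1 (nonpos_of_forall_le_smul hArch hq fun ε hε => ?_)
    obtain ⟨r, hr, hlt⟩ := exists_lt_of_lt_csSup ⟨_, hneg⟩ (sub_lt_self (sSup S) hε)
    rw [sub_le_comm, ← sub_smul]
    exact (smul_le_smul_of_nonneg_right hlt.le hq).trans hr

theorem SigmaDistributiveBP.exists_eq_smul
    (hσ : SigmaDistributiveBP (E := E))
    (hArch : ∀ x y : E, (∀ n : ℕ, n • x ≤ y) → x ≤ 0)
    (hDedekind : ∀ A : Set E, A.Nonempty → BddAbove A → ∃ s : E, IsLUB A s)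
    {x b : E} (hxb : |x| ≤ b)
    {π₀ : Module.End ℝ E} (hπ₀ : IsBandProjection π₀) (hne : π₀ ≠ 0) :
    ∃ π : Module.End ℝ E, IsBandProjection π ∧ π ≠ 0 ∧ π * π₀ = π ∧
      ∃ r : ℝ, |r| ≤ 1 ∧ π x = r • π b := by
  obtain ⟨t, ht⟩ := exists_surjective_nat ℚ
  choose s hs hsz using fun n => exists_bandProjection_eq_posPart hDedekind (x - (t n : ℝ) • b)
  obtain ⟨π, hπ, hπne, hππ₀, hdec⟩ := hσ.exists_deciding hDedekind hs hπ₀ hne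
  refine ⟨π, hπ, hπne, hππ₀, exists_eq_smul_of_comparable hArch ?_ fun r => ?_⟩
  · rw [hπ.abs_map]
    exact hπ.mono hxb
  · obtain ⟨n, rfl⟩ := ht r
    have key : s n (π (x - (t n : ℝ) • b)) = π (x - (t n : ℝ) • b)⁺ := by
      rw [(hs n).comm hπ, hsz]
    rw [← sub_nonneg, ← sub_nonpos (a := π x), ← map_smul, ← map_sub]
    rcases hdec n with h | h
    · right
      rw [h] at key
      exact (hπ.mono (le_posPart _)).trans_eq key.symm
    · left
      rw [h] at key
      rw [key]
      exact hπ.map_mono_nonneg (posPart_nonneg _)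

theorem SigmaDistributiveBP.abs_le_of_bandPreserving
    (hσ : SigmaDistributiveBP (E := E))
    (hArch : ∀ x y : E, (∀ n : ℕ, n • x ≤ y) → x ≤ 0)
    (hDedekind : ∀ A : Set E, A.Nonempty → BddAbove A → ∃ s : E, IsLUB A s)
    {T : E →ₗ[ℝ] E} (hT : BandPreserving T) {x b : E} (hxb : |x| ≤ b) : |T x| ≤ |T b| := by
  set w := |T x| - |T b| with hw
  obtain ⟨s, hs, hsw⟩ := exists_bandProjection_eq_posPart hDedekind w
  obtain ⟨σ, hσp, hσw, hσmin⟩ := exists_principal_bandProjection hDedekind w⁺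
  by_contra hcon
  have hσne : σ ≠ 0 := by
    rintro rfl
    refine hcon (sub_nonpos.1 ?_)
    rw [← hw, ← posPart_eq_zero, ← hσw]
    rfl
  obtain ⟨π, hπ, hπne, hπσ, r, hr, hxr⟩ := hσ.exists_eq_smul hArch hDedekind hxb hσp hσne
  have h1 : π w ≤ 0 := by
    rw [hw, map_sub, ← hπ.abs_map, ← hπ.abs_map, ← hT.map_comm hπ, ← hT.map_comm hπ, hxr, map_smul,
      sub_nonpos]
    refine (latticeAbs_smul_le _ _).trans ?_
    exact (smul_le_smul_of_nonneg_right hr (abs_nonneg _)).trans_eq (one_smul _ _)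
  have h2 : π w⁺ = 0 := by
    refine le_antisymm ?_ (hπ.map_mono_nonneg (posPart_nonneg w))
    rw [← hsw, hπ.comm hs]
    simpa using hs.mono h1
  exact hπne (hπσ ▸ hσmin π hπ h2)

theorem SigmaDistributiveBP.orderBounded
    (hσ : SigmaDistributiveBP (E := E))
    (hArch : ∀ x y : E, (∀ n : ℕ, n • x ≤ y) → x ≤ 0)
    (hDedekind : ∀ A : Set E, A.Nonempty → BddAbove A → ∃ s : E, IsLUB A s)
    {T : E →ₗ[ℝ] E} (hT : BandPreserving T) : OrderBounded T := by
  refine fun a b => ⟨-|T (|a| ⊔ |b|)|, |T (|a| ⊔ |b|)|, fun x hax hxb => ?_⟩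
  have hx : |x| ≤ |a| ⊔ |b| := abs_le'.2 ⟨(hxb.trans (le_abs_self b)).trans le_sup_right,
    ((neg_le_neg hax).trans (neg_le_abs a)).trans le_sup_left⟩
  have h := abs_le'.1 (hσ.abs_le_of_bandPreserving hArch hDedekind hT hx)
  exact ⟨neg_le.1 h.2, h.1⟩

end SigmaDistributive

section Gluing

variable [Lattice E] [AddCommGroup E] [IsOrderedAddMonoid E] [Module ℝ E]

theorem IsBandProjection.map_eq_self_of_abs_le {π : Module.End ℝ E} (hπ : IsBandProjection π)
    {x y : E} (hx : π x = x) (hyx : |y| ≤ |x|) : π y = y := by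
  have h := hπ.one_sub.mono hyx
  rw [← hπ.one_sub.abs_map, ← hπ.one_sub.abs_map] at h
  have hx' : (1 - π) x = 0 := by simp [hx]
  rw [hx', abs_zero] at h
  have := latticeAbs_eq_zero_iff.1 (le_antisymm h (abs_nonneg _))
  exact (sub_eq_zero.1 (by simpa using this)).symm

theorem IsBandProjection.map_isLUB {π : Module.End ℝ E} (hπ : IsBandProjection π)
    {A : Set E} {w a : E} (hw : IsLUB A w) (ha : a ∈ A) (ha0 : 0 ≤ a) (haπ : π a = a)
    (h0 : ∀ a' ∈ A, a' ≠ a → π a' = 0) (hw0 : 0 ≤ w) : π w = a := by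
  refine le_antisymm ?_ (haπ ▸ hπ.mono (hw.1 ha))
  suffices w ≤ w - π w + a by
    rw [sub_add, le_sub_self_iff] at this
    exact sub_nonpos.1 this
  have hsub : 0 ≤ w - π w := sub_nonneg.2 (hπ.2 w hw0).2
  refine hw.2 fun a' ha' => ?_
  by_cases haa : a' = a
  · rw [haa]
    exact le_add_of_nonneg_left hsub
  · refine le_add_of_le_of_nonneg ?_ ha0
    have := hπ.one_sub.mono (hw.1 ha')
    simpa [h0 a' ha' haa] using this

theorem exists_glue_nonneg
    (hDedekind : ∀ A : Set E, A.Nonempty → BddAbove A → ∃ s : E, IsLUB A s)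
    (hUnivComplete : ∀ A : Set E, (∀ x ∈ A, 0 ≤ x) →
      (A.Pairwise fun x y => |x| ⊓ |y| = 0) → BddAbove A)
    {D : Set (Module.End ℝ E)} (hD : ∀ π ∈ D, IsBandProjection π)
    (hpair : D.Pairwise fun π ρ => π * ρ = 0) {g : Module.End ℝ E → E}
    (hg0 : ∀ π ∈ D, 0 ≤ g π) (hg : ∀ π ∈ D, π (g π) = g π) :
    ∃ w, ∀ π ∈ D, π w = g π := by
  have hkill : ∀ π ∈ D, ∀ a ∈ insert 0 (g '' D), a ≠ g π → π a = 0 := by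
    rintro π hπ a (rfl | ⟨ρ, hρ, rfl⟩) hne
    · exact map_zero _
    · have hπρ : π ≠ ρ := fun h => hne (h ▸ rfl)
      rw [← hg ρ hρ, ← Module.End.mul_apply, hpair hπ hρ hπρ]
      rfl
  have hpos : ∀ a ∈ insert 0 (g '' D), 0 ≤ a := by
    rintro a (rfl | ⟨π, hπ, rfl⟩)
    exacts [le_rfl, hg0 π hπ]
  obtain ⟨w, hw⟩ := hDedekind (insert 0 (g '' D)) ⟨0, Set.mem_insert _ _⟩ <| by
    refine hUnivComplete _ hpos ?_
    rintro a (rfl | ⟨π, hπ, rfl⟩) b hb hab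
    · simp
    · exact (hD π hπ).disjoint (hg π hπ) (hkill π hπ b hb hab.symm)
  exact ⟨w, fun π hπ => (hD π hπ).map_isLUB hw (Set.mem_insert_of_mem _ ⟨π, hπ, rfl⟩) (hg0 π hπ)
    (hg π hπ) (hkill π hπ) (hw.1 (Set.mem_insert _ _))⟩

theorem exists_glue_of_pairwise
    (hDedekind : ∀ A : Set E, A.Nonempty → BddAbove A → ∃ s : E, IsLUB A s)
    (hUnivComplete : ∀ A : Set E, (∀ x ∈ A, 0 ≤ x) →
      (A.Pairwise fun x y => |x| ⊓ |y| = 0) → BddAbove A)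
    {D : Set (Module.End ℝ E)} (hD : ∀ π ∈ D, IsBandProjection π)
    (hpair : D.Pairwise fun π ρ => π * ρ = 0) {f : Module.End ℝ E → E}
    (hf : ∀ π ∈ D, π (f π) = f π) : ∃ w, ∀ π ∈ D, π w = f π := by
  obtain ⟨u, hu⟩ := exists_glue_nonneg hDedekind hUnivComplete hD hpair (g := fun π => (f π)⁺)
    (fun _ _ => posPart_nonneg _) fun π hπ => (hD π hπ).map_eq_self_of_abs_le (hf π hπ) <| by
      rw [abs_of_nonneg (posPart_nonneg _), ← posPart_add_negPart]
      exact le_add_of_nonneg_right (negPart_nonneg _)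
  obtain ⟨v, hv⟩ := exists_glue_nonneg hDedekind hUnivComplete hD hpair (g := fun π => (f π)⁻)
    (fun _ _ => negPart_nonneg _) fun π hπ => (hD π hπ).map_eq_self_of_abs_le (hf π hπ) <| by
      rw [abs_of_nonneg (negPart_nonneg _), ← posPart_add_negPart]
      exact le_add_of_nonneg_left (posPart_nonneg _)
  exact ⟨u - v, fun π hπ => by rw [map_sub, hu π hπ, hv π hπ, posPart_sub_negPart]⟩

variable [PosSMulMono ℝ E]

/-- A compatible family indexed by an ideal of band projections can be glued. -/
theorem exists_glue
    (hDedekind : ∀ A : Set E, A.Nonempty → BddAbove A → ∃ s : E, IsLUB A s)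
    (hUnivComplete : ∀ A : Set E, (∀ x ∈ A, 0 ≤ x) →
      (A.Pairwise fun x y => |x| ⊓ |y| = 0) → BddAbove A)
    {I : Set (Module.End ℝ E)} (hI : ∀ π ∈ I, IsBandProjection π)
    (hideal : ∀ π ∈ I, ∀ ρ, IsBandProjection ρ → ρ * π ∈ I) {f : Module.End ℝ E → E}
    (hf : ∀ π ∈ I, π (f π) = f π) (hcompat : ∀ π ∈ I, ∀ ρ ∈ I, π (f ρ) = ρ (f π)) :
    ∃ w, ∀ π ∈ I, π w = f π := by
  obtain ⟨D, ⟨hDI, hpair⟩, hmax⟩ := zorn_subset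
    {D : Set (Module.End ℝ E) | D ⊆ I ∧ D.Pairwise fun π ρ => π * ρ = 0} <| by
      refine fun c hc hchain => ⟨⋃₀ c, ⟨Set.sUnion_subset fun D hD => (hc hD).1, ?_⟩,
        fun D hD => Set.subset_sUnion_of_mem hD⟩
      exact (Set.pairwise_sUnion hchain.directedOn).2 fun D hD => (hc hD).2
  obtain ⟨w, hw⟩ := exists_glue_of_pairwise hDedekind hUnivComplete (fun π hπ => hI π (hDI hπ))
    hpair fun π hπ => hf π (hDI hπ)
  refine ⟨w, fun π hπ => sub_eq_zero.1 ?_⟩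
  obtain ⟨σ, hσ, hσz, hmin⟩ := exists_principal_bandProjection hDedekind (π w - f π)
  have hbπ := hI π hπ
  have hσI : σ ∈ I := by
    have h := hmin _ hbπ.one_sub (by simp [hbπ.idem, hf π hπ])
    rw [sub_mul, one_mul, sub_eq_zero] at h
    have h' : σ * π = σ := by
      conv_rhs => rw [h]
      exact LinearMap.ext fun x => hσ.comm hbπ x
    exact h' ▸ hideal π hπ σ hσ
  have horth : ∀ ρ ∈ D, ρ * σ = 0 := fun ρ hρ => hmin ρ (hI ρ (hDI hρ)) <| by
    rw [map_sub, (hI ρ (hDI hρ)).comm hbπ, hw ρ hρ, hcompat π hπ ρ (hDI hρ), sub_self]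
  have hσD : σ ∈ D := by
    refine hmax ⟨Set.insert_subset hσI hDI, ?_⟩ (Set.subset_insert σ D) (Set.mem_insert σ D)
    refine (Set.pairwise_insert).2 ⟨hpair, fun ρ hρ _ => ⟨?_, horth ρ hρ⟩⟩
    rw [← horth ρ hρ]
    exact LinearMap.ext fun x => hσ.comm (hI ρ (hDI hρ)) x
  have h0 := horth σ hσD
  rw [← hσz, ← hσz, ← Module.End.mul_apply, h0]
  rfl

end Gluing

section Baer

variable [Lattice E] [AddCommGroup E] [IsOrderedAddMonoid E] [Module ℝ E]

variable (E) in
/-- The algebra of operators generated by the band projections. -/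
abbrev bandAlgebra : Subalgebra ℝ (Module.End ℝ E) :=
  Algebra.adjoin ℝ {π | IsBandProjection π}

/-- A band projection as an element of `bandAlgebra E`. -/
def IsBandProjection.toBandAlgebra {π : Module.End ℝ E} (hπ : IsBandProjection π) :
    bandAlgebra E :=
  ⟨π, Algebra.subset_adjoin hπ⟩

theorem IsBandProjection.toBandAlgebra_smul {π : Module.End ℝ E} (hπ : IsBandProjection π)
    (x : E) : hπ.toBandAlgebra • x = π x := rfl

/-- Elements of the algebra generated by the band projections are locally scalar. -/
theorem exists_mul_eq_smul_of_mem_bandAlgebra {s : Module.End ℝ E} (hs : s ∈ bandAlgebra E)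
    {π : Module.End ℝ E} (hπ : IsBandProjection π) (hne : π ≠ 0) :
    ∃ ρ : Module.End ℝ E, IsBandProjection ρ ∧ ρ ≠ 0 ∧ ρ * π = ρ ∧ ∃ a : ℝ, ρ * s = a • ρ := by
  induction hs using Algebra.adjoin_induction generalizing π with
  | mem σ hσ =>
    by_cases h : σ * π = 0
    · refine ⟨π, hπ, hne, hπ.1, 0, ?_⟩
      rw [zero_smul, ← h]
      exact LinearMap.ext fun x => hπ.comm hσ x
    · refine ⟨σ * π, hσ.mul hπ, h, ?_, 1, LinearMap.ext fun x => ?_⟩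
      · rw [mul_assoc]
        congr 1
        exact hπ.1
      · simp [hπ.comm hσ, hσ.idem]
  | algebraMap r => exact ⟨π, hπ, hne, hπ.1, r, by rw [← Algebra.commutes, Algebra.smul_def]⟩
  | add s t _ _ ihs iht =>
    obtain ⟨ρ, hρ, hρ0, hρπ, a, ha⟩ := ihs hπ hne
    obtain ⟨σ, hσ, hσ0, hσρ, b, hb⟩ := iht hρ hρ0
    refine ⟨σ, hσ, hσ0, by rw [← hσρ, mul_assoc, hρπ], a + b, ?_⟩
    have : σ * s = a • σ := by rw [← hσρ, mul_assoc, ha, mul_smul_comm]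
    rw [mul_add, this, hb, add_smul]
  | mul s t _ _ ihs iht =>
    obtain ⟨ρ, hρ, hρ0, hρπ, a, ha⟩ := ihs hπ hne
    obtain ⟨σ, hσ, hσ0, hσρ, b, hb⟩ := iht hρ hρ0
    refine ⟨σ, hσ, hσ0, by rw [← hσρ, mul_assoc, hρπ], a * b, ?_⟩
    have : σ * s = a • σ := by rw [← hσρ, mul_assoc, ha, mul_smul_comm]
    rw [← mul_assoc, this, smul_mul_assoc, hb, mul_smul]

/-- A universally complete vector lattice is an injective module over the algebra generated by
its band projections. -/
theorem baer_bandAlgebra [PosSMulMono ℝ E]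
    (hDedekind : ∀ A : Set E, A.Nonempty → BddAbove A → ∃ s : E, IsLUB A s)
    (hUnivComplete : ∀ A : Set E, (∀ x ∈ A, 0 ≤ x) →
      (A.Pairwise fun x y => |x| ⊓ |y| = 0) → BddAbove A) :
    Module.Baer (bandAlgebra E) E := by
  intro I g
  have hg : ∀ t r (hr : r ∈ I), g ⟨t * r, I.mul_mem_left t hr⟩ = t • g ⟨r, hr⟩ :=
    fun t r hr => g.map_smul t ⟨r, hr⟩
  set P : Set (Module.End ℝ E) :=
    {π | ∃ h : IsBandProjection π, h.toBandAlgebra ∈ I}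
  classical
  set f : Module.End ℝ E → E := fun π =>
    if h : ∃ h : IsBandProjection π, h.toBandAlgebra ∈ I then g ⟨h.1.toBandAlgebra, h.2⟩ else 0
  have hfP : ∀ {π : Module.End ℝ E} (h : IsBandProjection π) (hI : h.toBandAlgebra ∈ I),
      f π = g ⟨h.toBandAlgebra, hI⟩ := fun h hI => dif_pos ⟨h, hI⟩
  have hmulmem : ∀ {π ρ : Module.End ℝ E} (hπ : IsBandProjection π) (hρ : IsBandProjection ρ),
      hπ.toBandAlgebra ∈ I → (hρ.mul hπ).toBandAlgebra ∈ I := fun hπ hρ hI =>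
    I.mul_mem_left hρ.toBandAlgebra hI
  have hfmul : ∀ {π ρ : Module.End ℝ E} (_ : π ∈ P) (_ : IsBandProjection ρ),
      f (ρ * π) = ρ (f π) := by
    rintro π ρ ⟨hπ, hI⟩ hρ
    rw [hfP hπ hI, hfP (hρ.mul hπ) (hmulmem hπ hρ hI), ← hρ.toBandAlgebra_smul, ← hg]
    rfl
  obtain ⟨w, hw⟩ := exists_glue hDedekind hUnivComplete (I := P) (f := f) (fun π hπ => hπ.1)
    (fun π hπ ρ hρ => ⟨hρ.mul hπ.1, hmulmem hπ.1 hρ hπ.2⟩)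
    (fun π hπ => by
      rw [← hfmul hπ hπ.1]
      congr 1
      exact hπ.1.1)
    (fun π hπ ρ hρ => by
      rw [← hfmul hπ hρ.1, ← hfmul hρ hπ.1]
      congr 1
      exact LinearMap.ext fun x => hπ.1.comm hρ.1 x)
  refine ⟨LinearMap.toSpanSingleton _ E w, fun s hs => ?_⟩
  rw [LinearMap.toSpanSingleton_apply]
  refine (sub_eq_zero.1 ?_).symm
  obtain ⟨σ, hσ, hσz, hmin⟩ := exists_principal_bandProjection hDedekind (g ⟨s, hs⟩ - s • w)
  by_contra hz
  have hσ0 : σ ≠ 0 := by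
    rintro rfl
    exact hz hσz.symm
  obtain ⟨ρ, hρ, hρ0, hρσ, a, ha⟩ := exists_mul_eq_smul_of_mem_bandAlgebra s.2 hσ hσ0
  refine hρ0 ?_
  rw [← hρσ]
  refine hmin ρ hρ ?_
  have hmul : hρ.toBandAlgebra * s = a • hρ.toBandAlgebra := Subtype.ext ha
  have h1 : ρ (s • w) = a • ρ w := LinearMap.congr_fun ha w
  have h2 : ρ (g ⟨s, hs⟩) = g ⟨hρ.toBandAlgebra * s, I.mul_mem_left _ hs⟩ := by
    rw [hg, hρ.toBandAlgebra_smul]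
  rw [map_sub, h1, h2]
  by_cases ha0 : a = 0
  · have : hρ.toBandAlgebra * s = 0 := by rw [hmul, ha0, zero_smul]
    have hI0 : (⟨hρ.toBandAlgebra * s, I.mul_mem_left _ hs⟩ : I) = 0 := Subtype.ext this
    rw [hI0, map_zero, ha0, zero_smul, sub_zero]
  · have hI : hρ.toBandAlgebra ∈ I := by
      have h3 : algebraMap ℝ (bandAlgebra E) a⁻¹ * (hρ.toBandAlgebra * s) ∈ I :=
        I.mul_mem_left _ (I.mul_mem_left _ hs)
      rwa [hmul, ← Algebra.smul_def, smul_smul, inv_mul_cancel₀ ha0, one_smul] at h3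
    have hI' : (⟨hρ.toBandAlgebra * s, I.mul_mem_left _ hs⟩ : I) =
        ⟨algebraMap ℝ (bandAlgebra E) a * hρ.toBandAlgebra, I.mul_mem_left _ hI⟩ :=
      Subtype.ext (hmul.trans (Algebra.smul_def _ _))
    rw [hI', hg _ _ hI, ← hfP hρ hI, ← hw ρ ⟨hρ, hI⟩, sub_eq_zero]
    rfl

end Baer

section Unbounded

variable [Lattice E] [AddCommGroup E] [IsOrderedAddMonoid E] [Module ℝ E] [PosSMulMono ℝ E]

theorem bandPreserving_of_map_comm
    (hDedekind : ∀ A : Set E, A.Nonempty → BddAbove A → ∃ s : E, IsLUB A s) {T : E →ₗ[ℝ] E}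
    (hT : ∀ π : Module.End ℝ E, IsBandProjection π → ∀ x, T (π x) = π (T x)) :
    BandPreserving T := by
  intro x y hxy
  obtain ⟨π, hπ, h1, h2⟩ := exists_bandProjection hDedekind {x}
  refine hπ.disjoint ?_ (h2 y fun a ha => ?_)
  · rw [← hT π hπ, h1 x rfl]
  · rw [Set.mem_singleton_iff.1 ha, inf_comm, hxy]

/-- If `x` is nowhere proportional to `e`, some band preserving operator kills `e` and maps `x`
to `e`. -/
theorem exists_bandPreserving_of_nowhere_proportional
    (hDedekind : ∀ A : Set E, A.Nonempty → BddAbove A → ∃ s : E, IsLUB A s)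
    (hUnivComplete : ∀ A : Set E, (∀ x ∈ A, 0 ≤ x) →
      (A.Pairwise fun x y => |x| ⊓ |y| = 0) → BddAbove A)
    {e x : E} (h : ∀ π : Module.End ℝ E, IsBandProjection π → ∀ r : ℝ, π x = r • π e → π e = 0) :
    ∃ T : E →ₗ[ℝ] E, BandPreserving T ∧ T e = 0 ∧ T x = e := by
  set R := bandAlgebra E
  have hker : ∀ s t : R, s • e + t • x = 0 → t • e = 0 := by
    intro s t hst
    by_contra hte
    obtain ⟨σ, hσ, hσte, hmin⟩ := exists_principal_bandProjection hDedekind (t • e)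
    have hσ0 : σ ≠ 0 := by
      rintro rfl
      exact hte hσte.symm
    obtain ⟨ρ', hρ', hρ'0, hρ'σ, a, ha'⟩ := exists_mul_eq_smul_of_mem_bandAlgebra s.2 hσ hσ0
    obtain ⟨ρ, hρ, hρ0, hρρ', b, hb⟩ := exists_mul_eq_smul_of_mem_bandAlgebra t.2 hρ' hρ'0
    have ha : ρ * s = a • ρ := by rw [← hρρ', mul_assoc, ha', mul_smul_comm]
    have hs : ∀ y, ρ (s • y) = a • ρ y := LinearMap.congr_fun ha
    have ht : ∀ y, ρ (t • y) = b • ρ y := LinearMap.congr_fun hb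
    refine hρ0 ?_
    rw [← hρρ', ← hρ'σ, ← mul_assoc, hρρ']
    refine hmin ρ hρ ?_
    rw [ht]
    by_cases hb0 : b = 0
    · rw [hb0, zero_smul]
    · rw [h ρ hρ (-(b⁻¹ * a)) ?_, smul_zero]
      have h0 : ρ (s • e + t • x) = 0 := by rw [hst, map_zero]
      rw [map_add, hs, ht, add_eq_zero_iff_eq_neg'] at h0
      rw [neg_smul, mul_smul, ← smul_neg, ← h0, smul_smul, inv_mul_cancel₀ hb0, one_smul]
  set φ : R × R →ₗ[R] E :=
    (LinearMap.toSpanSingleton R E e).coprod (LinearMap.toSpanSingleton R E x)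
  set ψ : R × R →ₗ[R] E := LinearMap.coprod 0 (LinearMap.toSpanSingleton R E e)
  have hle : LinearMap.ker φ ≤ LinearMap.ker ψ := by
    rintro ⟨s, t⟩ hst
    have := hker s t (by simpa [φ] using hst)
    simpa [ψ] using this
  obtain ⟨T, hT⟩ := (baer_bandAlgebra hDedekind hUnivComplete).extension_property
    ((LinearMap.ker φ).liftQ φ le_rfl)
    (LinearMap.ker_eq_bot.1 (Submodule.ker_liftQ_eq_bot _ _ _ le_rfl))
    ((LinearMap.ker φ).liftQ ψ hle)
  have hT' : ∀ p, T (φ p) = ψ p := fun p => by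
    simpa using LinearMap.congr_fun hT (Submodule.Quotient.mk p)
  refine ⟨T.restrictScalars ℝ, bandPreserving_of_map_comm hDedekind fun π hπ y => ?_, ?_, ?_⟩
  · exact T.map_smul hπ.toBandAlgebra y
  · simpa [φ, ψ] using hT' (1, 0)
  · simpa [φ, ψ] using hT' (0, 1)

/-- Partial sums of the ternary expansion with digits given by band projections. -/
noncomputable def ternarySum {E : Type*} [AddCommGroup E] [Module ℝ E]
    (s : ℕ → Module.End ℝ E) (e : E) (K : ℕ) : E :=
  ∑ k ∈ Finset.range K, (1 / 3 : ℝ) ^ k • s k e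

theorem ternarySum_succ {E : Type*} [AddCommGroup E] [Module ℝ E]
    (s : ℕ → Module.End ℝ E) (e : E) (K : ℕ) :
    ternarySum s e (K + 1) = ternarySum s e K + (1 / 3 : ℝ) ^ K • s K e :=
  Finset.sum_range_succ _ _

theorem exists_ternary_limit
    (hDedekind : ∀ A : Set E, A.Nonempty → BddAbove A → ∃ s : E, IsLUB A s)
    {s : ℕ → Module.End ℝ E} (hs : ∀ k, IsBandProjection (s k)) {e : E} (he : 0 ≤ e) :
    ∃ x, ∀ K, ternarySum s e K ≤ x ∧
      x ≤ ternarySum s e K + (3 / 2 * (1 / 3 : ℝ) ^ K) • e := by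
  have hmono : Monotone (ternarySum s e) := monotone_nat_of_le_succ fun K => by
    rw [ternarySum_succ]
    exact le_add_of_nonneg_right (smul_nonneg (by positivity) ((hs K).map_mono_nonneg he))
  have hanti : Antitone fun K => ternarySum s e K + (3 / 2 * (1 / 3 : ℝ) ^ K) • e :=
    antitone_nat_of_succ_le fun K => by
      have h1 : (1 / 3 : ℝ) ^ K • s K e ≤ (1 / 3 : ℝ) ^ K • e :=
        smul_le_smul_of_nonneg_left ((hs K).2 e he).2 (by positivity)
      rw [ternarySum_succ, add_assoc]
      refine add_le_add_right ((add_le_add_left h1 _).trans_eq ?_) _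
      rw [← add_smul]
      congr 1
      ring
  have hbound : ∀ K J, ternarySum s e J ≤ ternarySum s e K + (3 / 2 * (1 / 3 : ℝ) ^ K) • e :=
    fun K J => (hmono (le_max_left J K)).trans <|
      (le_add_of_nonneg_right (smul_nonneg (by positivity) he)).trans (hanti (le_max_right J K))
  obtain ⟨x, hx⟩ := hDedekind (Set.range (ternarySum s e)) (Set.range_nonempty _)
    ⟨_, by rintro _ ⟨J, rfl⟩; exact hbound 0 J⟩
  exact ⟨x, fun K => ⟨hx.1 ⟨K, rfl⟩, hx.2 (by rintro _ ⟨J, rfl⟩; exact hbound K J)⟩⟩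

/-- Where a ternary sum is proportional to `e`, all its digits are constant. -/
theorem ternary_digit_constant {e x : E} {s : ℕ → Module.End ℝ E}
    (hs : ∀ k, IsBandProjection (s k)) (he : 0 ≤ e) (hx : ∀ K, ternarySum s e K ≤ x ∧
      x ≤ ternarySum s e K + (3 / 2 * (1 / 3 : ℝ) ^ K) • e)
    {π : Module.End ℝ E} (hπ : IsBandProjection π) {r : ℝ} (hr : π x = r • π e) (k : ℕ) :
    s k (π e) = 0 ∨ s k (π e) = π e := by
  have hy : 0 ≤ π e := hπ.map_mono_nonneg he
  have key : ∀ (k : ℕ) (μ : ℝ), π (ternarySum s e k) = μ • π e →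
      s k (π e) = 0 ∨ s k (π e) = π e := by
    intro k μ hμ
    by_contra! hcon
    obtain ⟨hp, hq⟩ := hcon
    set c : ℝ := (1 / 3 : ℝ) ^ k
    have hc : 0 < c := by positivity
    have h1 : c • s k (π e) ≤ (r - μ) • π e := by
      have := hπ.mono (hx (k + 1)).1
      rw [ternarySum_succ, map_add, map_smul, hr, hμ, hπ.comm (hs k)] at this
      rw [sub_smul]
      exact le_sub_iff_add_le'.2 this
    have h2 : (r - μ) • π e ≤ c • s k (π e) + (c / 2) • π e := by
      have := hπ.mono (hx (k + 1)).2
      rw [ternarySum_succ, map_add, map_add, map_smul, map_smul, hr, hμ, hπ.comm (hs k)] at this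
      rw [sub_smul, sub_le_iff_le_add', ← add_assoc]
      convert this using 3
      simp only [c]
      ring
    have h3 : c ≤ r - μ := by
      refine le_of_smul_le_smul_of_ne_zero ((hs k).map_mono_nonneg hy) hp ?_
      simpa [(hs k).idem] using (hs k).mono h1
    have h4 : r - μ ≤ c / 2 := by
      refine le_of_smul_le_smul_of_ne_zero ((hs k).one_sub.map_mono_nonneg hy) (q := (1 - s k) (π e))
        (fun h => hq (sub_eq_zero.1 h).symm) ?_
      have h5 := (hs k).one_sub.mono h2
      have h6 : (1 - s k) (s k (π e)) = 0 := by simp [(hs k).idem]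
      rwa [map_add, map_smul, map_smul, map_smul, h6, smul_zero, zero_add] at h5
    linarith
  have hμ : ∀ k, ∃ μ : ℝ, π (ternarySum s e k) = μ • π e := by
    intro k
    induction k with
    | zero => exact ⟨0, by simp [ternarySum]⟩
    | succ k ih =>
      obtain ⟨μ, hμ⟩ := ih
      rw [ternarySum_succ, map_add, map_smul, hμ, hπ.comm (hs k)]
      rcases key k μ hμ with h | h
      · exact ⟨μ, by rw [h, smul_zero, add_zero]⟩
      · exact ⟨μ + (1 / 3 : ℝ) ^ k, by rw [h, add_smul]⟩
  obtain ⟨μ, hμ⟩ := hμ k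
  exact key k μ hμ

/-- If all band preserving operators are order bounded, then for every sequence of band
projections and every nonzero positive `e`, some nonzero component of `e` decides the sequence. -/
theorem exists_deciding_component
    (hArch : ∀ x y : E, (∀ n : ℕ, n • x ≤ y) → x ≤ 0)
    (hDedekind : ∀ A : Set E, A.Nonempty → BddAbove A → ∃ s : E, IsLUB A s)
    (hUnivComplete : ∀ A : Set E, (∀ x ∈ A, 0 ≤ x) →
      (A.Pairwise fun x y => |x| ⊓ |y| = 0) → BddAbove A)
    (hbdd : ∀ T : E →ₗ[ℝ] E, BandPreserving T → OrderBounded T)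
    {s : ℕ → Module.End ℝ E} (hs : ∀ k, IsBandProjection (s k))
    {e : E} (he : 0 ≤ e) (he0 : e ≠ 0) :
    ∃ π : Module.End ℝ E, IsBandProjection π ∧ π e ≠ 0 ∧
      ∀ k, s k (π e) = 0 ∨ s k (π e) = π e := by
  obtain ⟨x, hx⟩ := exists_ternary_limit hDedekind hs he
  by_contra! hcon
  obtain ⟨T, hT, hTe, hTx⟩ := exists_bandPreserving_of_nowhere_proportional hDedekind hUnivComplete
    (e := e) (x := x) fun π hπ r hr => by
      by_contra hne
      obtain ⟨k, hk0, hk1⟩ := hcon π hπ hne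
      exact (ternary_digit_constant hs he hx hπ hr k).elim hk0 hk1
  obtain ⟨_, d, hd⟩ := hbdd T hT 0 ((3 / 2 : ℝ) • e)
  refine he0 (le_antisymm (hArch e d fun n => ?_) he)
  have hTn : T (ternarySum s e n) = 0 := by
    simp [ternarySum, hT.map_comm (hs _), hTe]
  have h1 : 0 ≤ (3 : ℝ) ^ n • (x - ternarySum s e n) :=
    smul_nonneg (by positivity) (sub_nonneg.2 (hx n).1)
  have h2 : (3 : ℝ) ^ n • (x - ternarySum s e n) ≤ (3 / 2 : ℝ) • e := by
    refine (smul_le_smul_of_nonneg_left (sub_le_iff_le_add'.2 (hx n).2) (by positivity)).trans_eq ?_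
    rw [smul_smul]
    congr 1
    rw [mul_left_comm, ← mul_pow]
    norm_num
  have h3 := (hd _ h1 h2).2
  rw [map_smul, map_sub, hTx, hTn, sub_zero] at h3
  refine le_trans ?_ h3
  rw [← Nat.cast_smul_eq_nsmul ℝ]
  refine smul_le_smul_of_nonneg_right ?_ he
  exact_mod_cast (Nat.lt_pow_self (by norm_num : 1 < 3)).le

theorem sigmaDistributiveBP_of_orderBounded
    (hArch : ∀ x y : E, (∀ n : ℕ, n • x ≤ y) → x ≤ 0)
    (hDedekind : ∀ A : Set E, A.Nonempty → BddAbove A → ∃ s : E, IsLUB A s)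
    (hUnivComplete : ∀ A : Set E, (∀ x ∈ A, 0 ≤ x) →
      (A.Pairwise fun x y => |x| ⊓ |y| = 0) → BddAbove A)
    (hbdd : ∀ T : E →ₗ[ℝ] E, BandPreserving T → OrderBounded T) :
    SigmaDistributiveBP (E := E) := by
  intro b hb c hc u hu d hd v hv
  have huv : bpLE u v := hv.2.2 u hu.1 <| by
    rintro _ ⟨φ, rfl⟩
    refine hu.2.2 _ (hd φ).1 ?_
    rintro _ ⟨n, rfl⟩ x hx
    exact ((hc n).2.1 _ ⟨φ n, rfl⟩ x hx).trans ((hd φ).2.1 _ ⟨n, rfl⟩ x hx)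
  refine LinearMap.ext (linearMap_ext_of_nonneg fun z hz => le_antisymm (huv z hz) ?_)
  set e := v (z - u z) with he_def
  have he : 0 ≤ e := hv.1.map_mono_nonneg (sub_nonneg.2 (hu.1.2 z hz).2)
  suffices e = 0 by
    rw [he_def, map_sub, sub_eq_zero] at this
    rw [this]
    exact (hv.1.2 _ (hu.1.map_mono_nonneg hz)).2
  by_contra he0
  obtain ⟨π, hπ, hy0, hdec⟩ := exists_deciding_component hArch hDedekind hUnivComplete hbdd
    (s := fun k => b k.unpair.1 k.unpair.2) (fun k => hb _ _) he he0
  set y := π e with hy_def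
  have hy : 0 ≤ y := hπ.map_mono_nonneg he
  have hvy : v y = y := by rw [hy_def, ← hπ.comm hv.1, he_def, hv.1.idem]
  have huy : u y = 0 := by
    rw [hy_def, ← hπ.comm hu.1, he_def, ← hv.1.comm hu.1, map_sub u, hu.1.idem, sub_self, map_zero,
      map_zero]
  obtain ⟨τ, hτ, hτy, hmin⟩ := exists_principal_bandProjection hDedekind y
  have hex : ∀ n, ∃ m, b n m y = 0 := by
    intro n
    by_contra! hne
    have hτc : bpLE τ (c n) := (hc n).2.2 τ hτ <| by
      rintro _ ⟨m, rfl⟩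
      have hbm : b n m y = y := by
        have := hdec (Nat.pair n m)
        simp only [Nat.unpair_pair] at this
        exact this.resolve_left (hne m)
      have := hmin _ (hb n m).one_sub (sub_eq_zero.2 hbm.symm)
      exact (hτ.bpLE_iff (hb n m)).2 fun x => (sub_eq_zero.1 (LinearMap.congr_fun this x)).symm
    refine hy0 (le_antisymm ?_ hy)
    calc y = τ y := hτy.symm
      _ ≤ c n y := hτc y hy
      _ ≤ u y := hu.2.1 _ ⟨n, rfl⟩ y hy
      _ = 0 := huy
  choose φ hφ using hex
  have hdτ : bpLE (d φ) (1 - τ : Module.End ℝ E) := (hd φ).2.2 _ hτ.one_sub <| by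
    rintro _ ⟨n, rfl⟩
    refine ((hb n _).bpLE_iff hτ.one_sub).2 fun x => ?_
    have := LinearMap.congr_fun (hmin _ (hb n (φ n)) (hφ n)) x
    simp only [Module.End.mul_apply, (hb n (φ n)).comm hτ, LinearMap.zero_apply] at this
    simp [this]
  refine hy0 (le_antisymm ?_ hy)
  calc y = v y := hvy.symm
    _ ≤ d φ y := hv.2.1 _ ⟨φ, rfl⟩ y hy
    _ ≤ (1 - τ : Module.End ℝ E) y := hdτ y hy
    _ = 0 := by simp [hτy]

end Unbounded

theorem bandPreserving_orderBounded_iff_sigmaDistributive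
    [Lattice E] [AddCommGroup E] [Module ℝ E]
    [CovariantClass E E (· + ·) (· ≤ ·)] [PosSMulMono ℝ E]
    (hArch : ∀ x y : E, (∀ n : ℕ, n • x ≤ y) → x ≤ 0)
    (hDedekind : ∀ A : Set E, A.Nonempty → BddAbove A → ∃ s : E, IsLUB A s)
    (hUnivComplete : ∀ A : Set E, (∀ x ∈ A, 0 ≤ x) →
      (A.Pairwise fun x y => |x| ⊓ |y| = 0) → BddAbove A) :
    (∀ T : E →ₗ[ℝ] E, BandPreserving T → OrderBounded T) ↔
      SigmaDistributiveBP (E := E) := by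
  have : IsOrderedAddMonoid E :=
    { add_le_add_left := fun a b hab c => by
        simpa only [add_comm _ c] using (‹CovariantClass E E (· + ·) (· ≤ ·)›).elim c hab }
  exact ⟨sigmaDistributiveBP_of_orderBounded hArch hDedekind hUnivComplete,
    fun hσ _ hT => hσ.orderBounded hArch hDedekind hT⟩
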